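/- Let d ≥ 2 and M ≥ 1 be integers. For every integer k ≥ 1 and every integer t ≥ 0, G(t+1, k) ≤ G(t, k). (Unimodality: the number of grounded M-Lipschitz functions with a given root value is non-increasing as the root value moves away from 0.) -/

import Mathlib

/-- The vertices of the rooted `d`-ary tree of depth `k`: sequences over `Fin d`
of length at most `k`.  The root is the empty sequence, the children of a vertex
`l` with `l.length < k` are the vertices `l ++ [j]` for `j : Fin d`, and the
leaves are the vertices of length exactly `k`. -/
abbrev Vtx (d k : ℕ) : Type := {l : List (Fin d) // l.length ≤ k}

/-- The root `v₀` of the tree. -/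
def rootV (d k : ℕ) : Vtx d k := ⟨[], by simp⟩

/-- `L_M(d,k)`: the set of integer-valued `M`-Lipschitz functions on the
`d`-ary tree of depth `k` that vanish on all leaves. -/
def LM (d k M : ℕ) : Set (Vtx d k → ℤ) :=
  {f | (∀ v : Vtx d k, v.1.length = k → f v = 0) ∧
       (∀ (l : List (Fin d)) (hl : l.length + 1 ≤ k) (j : Fin d),
         |f ⟨l ++ [j], by simpa using hl⟩ - f ⟨l, Nat.le_of_succ_le hl⟩| ≤ (M : ℤ))}

/-- `G(t,k)`: the number of functions in `L_M(d,k)` whose value at the root is `t`. -/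
noncomputable def G (d k M : ℕ) (t : ℤ) : ℕ :=
  Nat.card {f : Vtx d k → ℤ // f ∈ LM d k M ∧ f (rootV d k) = t}

/-- The probability that a uniformly random element of `L_M(d,k)` takes the
value `t` at the root. -/
noncomputable def PrRoot (d k M : ℕ) (t : ℤ) : ℝ :=
  (G d k M t : ℝ) / (Nat.card (LM d k M) : ℝ)

/-- The functions counted by `G d k M t`. -/
abbrev RootFiber (d k M : ℕ) (t : ℤ) : Type :=
  {f : Vtx d k → ℤ // f ∈ LM d k M ∧ f (rootV d k) = t}

/-- The grounded functions whose root value may be attached below a vertex of value `t`. -/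
abbrev RootWindow (d k M : ℕ) (t : ℤ) : Type :=
  {f : Vtx d k → ℤ // f ∈ LM d k M ∧ |f (rootV d k) - t| ≤ (M : ℤ)}

/-- The function on the tree of depth `k + 1` with root value `t` and with restriction `g i`
to the `i`-th subtree below the root. -/
def glue {d k : ℕ} (t : ℤ) (g : Fin d → Vtx d k → ℤ) : Vtx d (k + 1) → ℤ
  | ⟨[], _⟩ => t
  | ⟨i :: l, h⟩ => g i ⟨l, Nat.le_of_succ_le_succ h⟩

/-- Cutting off the root identifies a function of given root value with the family of its
restrictions to the subtrees below the root. -/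
def rootFiberSuccEquiv (d k M : ℕ) (t : ℤ) :
    RootFiber d (k + 1) M t ≃ (Fin d → RootWindow d k M t) where
  toFun f i := ⟨fun v => f.1 ⟨i :: v.1, Nat.succ_le_succ v.2⟩, by
    obtain ⟨f, ⟨hleaf, hlip⟩, rfl⟩ := f
    refine ⟨⟨fun v hv => hleaf _ (by simp [hv]), fun l hl j => ?_⟩, ?_⟩
    · exact hlip (i :: l) (Nat.succ_le_succ hl) j
    · exact hlip [] (by simp) i⟩
  invFun g := ⟨glue t fun i => (g i).1, by
    refine ⟨⟨?_, ?_⟩, rfl⟩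
    · rintro ⟨_ | ⟨i, l⟩, h⟩ hv
      · simp at hv
      · exact (g i).2.1.1 ⟨l, _⟩ (Nat.succ_injective hv)
    · rintro (_ | ⟨i, l⟩) hl j
      · exact (g j).2.2
      · exact (g i).2.1.2 l (Nat.le_of_succ_le_succ hl) j⟩
  left_inv := by
    rintro ⟨f, hf, rfl⟩
    ext ⟨_ | ⟨i, l⟩, h⟩ <;> rfl
  right_inv _ := rfl

/-- A window splits according to the root value. -/
def rootWindowEquiv (d k M : ℕ) (t : ℤ) :
    RootWindow d k M t ≃
      Σ s : Finset.Icc (t - (M : ℤ)) (t + M), RootFiber d k M s where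
  toFun f := ⟨⟨f.1 (rootV d k), by
    have := abs_le.1 f.2.2
    rw [Finset.mem_Icc]
    constructor <;> linarith⟩, ⟨f.1, f.2.1, rfl⟩⟩
  invFun p := ⟨p.2.1, p.2.2.1, by
    have := Finset.mem_Icc.1 p.1.2
    rw [p.2.2.2, abs_le]
    constructor <;> linarith⟩
  left_inv _ := rfl
  right_inv := by
    rintro ⟨⟨s, hs⟩, ⟨f, hf, h⟩⟩
    dsimp only at h
    subst h
    rfl

instance finite_rootFiber (d k M : ℕ) (t : ℤ) : Finite (RootFiber d k M t) := by
  induction k generalizing t with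
  | zero =>
    have : Subsingleton (RootFiber d 0 M t) := ⟨fun f g => by
      ext v
      have hv : v.1.length = 0 := Nat.le_zero.1 v.2
      rw [f.2.1.1 v hv, g.2.1.1 v hv]⟩
    infer_instance
  | succ k ih =>
    have : Finite (RootWindow d k M t) := Finite.of_equiv _ (rootWindowEquiv d k M t).symm
    exact Finite.of_equiv _ (rootFiberSuccEquiv d k M t).symm

lemma G_succ (d k M : ℕ) (t : ℤ) :
    G d (k + 1) M t = (∑ s ∈ Finset.Icc (t - (M : ℤ)) (t + M), G d k M s) ^ d := by
  rw [G, Nat.card_congr (rootFiberSuccEquiv d k M t), Nat.card_fun, Nat.card_fin,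
    Nat.card_congr (rootWindowEquiv d k M t), Nat.card_sigma]
  congr 1
  exact Finset.sum_coe_sort (Finset.Icc (t - (M : ℤ)) (t + M)) fun s => G d k M s

lemma neg_mem_LM {d k M : ℕ} {f : Vtx d k → ℤ} (hf : f ∈ LM d k M) : -f ∈ LM d k M := by
  refine ⟨fun v hv => by simp [hf.1 v hv], fun l hl j => ?_⟩
  have h := hf.2 l hl j
  rw [abs_sub_comm] at h
  simpa only [Pi.neg_apply, neg_sub_neg] using h

lemma G_neg (d k M : ℕ) (t : ℤ) : G d k M (-t) = G d k M t :=
  Nat.card_congr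
    { toFun := fun f => ⟨-f.1, neg_mem_LM f.2.1, by simp [f.2.2]⟩
      invFun := fun f => ⟨-f.1, neg_mem_LM f.2.1, by simp [f.2.2]⟩
      left_inv := fun f => by simp
      right_inv := fun f => by simp }

lemma G_natAbs (d k M : ℕ) (t : ℤ) : G d k M t.natAbs = G d k M t := by
  rcases Int.natAbs_eq t with h | h
  · rw [← h]
  · conv_rhs => rw [h, G_neg]

lemma sum_Icc_shift_le {g : ℤ → ℕ} {a b : ℤ} (hab : a ≤ b + 1) (h : g (b + 1) ≤ g a) :
    ∑ s ∈ Finset.Icc (a + 1) (b + 1), g s ≤ ∑ s ∈ Finset.Icc a b, g s := by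
  rcases hab.eq_or_lt with rfl | hab
  · simp
  have h₁ : Finset.Icc (a + 1) (b + 1) = insert (b + 1) (Finset.Icc (a + 1) b) := by
    ext x
    simp only [Finset.mem_Icc, Finset.mem_insert]
    omega
  have h₂ : Finset.Icc a b = insert a (Finset.Icc (a + 1) b) := by
    ext x
    simp only [Finset.mem_Icc, Finset.mem_insert]
    omega
  rw [h₁, h₂, Finset.sum_insert (by simp), Finset.sum_insert (by simp)]
  exact Nat.add_le_add_right h _

lemma G_add_one_le (d M k : ℕ) (t : ℤ) (ht : 0 ≤ t) : G d k M (t + 1) ≤ G d k M t := by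
  induction k generalizing t with
  | zero =>
    have : IsEmpty (RootFiber d 0 M (t + 1)) := ⟨fun f => by
      have h₀ := f.2.1.1 (rootV d 0) rfl
      have h₁ := f.2.2
      omega⟩
    rw [G, Nat.card_of_isEmpty]
    exact Nat.zero_le _
  | succ k ih =>
    have anti : Antitone fun n : ℕ => G d k M n :=
      antitone_nat_of_succ_le fun n => by exact_mod_cast ih n n.cast_nonneg
    have key : G d k M (t + M + 1) ≤ G d k M (t - M) := by
      rw [← G_natAbs d k M (t + M + 1), ← G_natAbs d k M (t - M)]
      exact anti (by omega)
    rw [G_succ, G_succ, add_sub_right_comm, add_right_comm]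
    exact Nat.pow_le_pow_left (sum_Icc_shift_le (by omega) key) d

/-- **Unimodality.**  For every `k ≥ 1` and every integer `t ≥ 0`,
`G(t+1,k) ≤ G(t,k)`. -/
theorem G_antitone (d M : ℕ) (hd : 2 ≤ d) (hM : 1 ≤ M) (k : ℕ) (hk : 1 ≤ k)
    (t : ℤ) (ht : 0 ≤ t) :
    G d k M (t + 1) ≤ G d k M t := by
  exact G_add_one_le d M k t ht
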